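/- arXiv:0810.2861 — 6 statements merged into one kernel-verified Lean document; each statement's English description precedes it below -/
import Mathlib

section
/- Let P be a soft constraint satisfaction problem over a linearly ordered commutative monoid M in which multiplication is strictly monotonic. Then every optimal solution of P is a Nash equilibrium of the associated local game L(P). -/
/-- An (abstract) soft constraint satisfaction problem (SCSP) over a linearly
ordered commutative monoid `M` (written multiplicatively), with variable set `V`.
Each constraint `c` has a scope `con c ⊆ V` and a valuation `val c`, canonically
extended to full assignments, which only depends on the variables in the scope. -/
structure SCSP (V : Type) (M : Type) [LinearOrder M] [CommMonoid M] where
  /-- the (nonempty) domain of each variable -/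
  D : V → Type
  Dne : ∀ v, Nonempty (D v)
  /-- index type for the (finitely many) constraints -/
  ι : Type
  fin : Fintype ι
  /-- the scope of each constraint -/
  con : ι → Finset V
  /-- the valuation of each constraint, canonically extended to full assignments -/
  val : ι → ((v : V) → D v) → M
  /-- the valuation only depends on the variables in the scope -/
  val_scope : ∀ c s s', (∀ v ∈ con c, s v = s' v) → val c s = val c s'

namespace SCSP

variable {V M : Type} [LinearOrder M] [CommMonoid M] (P : SCSP V M)

/-- The preference of a full assignment: the combination of the valuations of
all constraints. -/
def pref (s : (v : V) → P.D v) : M :=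
  letI := P.fin
  ∏ c : P.ι, P.val c s

/-- The payoff of player `v` in the local game `L(P)`: the combination of the
valuations of the constraints whose scope contains `v`. -/
noncomputable def payoff (v : V) (s : (w : V) → P.D w) : M :=
  letI := P.fin
  letI := Classical.decPred (fun c : P.ι => v ∈ P.con c)
  ∏ c ∈ Finset.univ.filter (fun c => v ∈ P.con c), P.val c s

/-- A full assignment is optimal if no full assignment has a strictly higher
preference. -/
def Optimal (s : (v : V) → P.D v) : Prop :=
  ¬ ∃ s' : (v : V) → P.D v, P.pref s < P.pref s'

/-- A full assignment is a Nash equilibrium of the local game `L(P)` if no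
player `v` can strictly increase its payoff by unilaterally changing its value. -/
def NashLocal [DecidableEq V] (s : (v : V) → P.D v) : Prop :=
  ∀ (v : V) (d : P.D v), P.payoff v (Function.update s v d) ≤ P.payoff v s

end SCSP

namespace SCSP

/-- The preference splits into the payoff of `v` and a factor that does not depend on the value
assigned to `v`. -/
theorem exists_pref_update_eq_mul_payoff {V M : Type} [LinearOrder M] [CommMonoid M]
    [DecidableEq V] (P : SCSP V M) (s : (v : V) → P.D v) (v : V) :
    ∃ r : M, ∀ d : P.D v,
      P.pref (Function.update s v d) = r * P.payoff v (Function.update s v d) := by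
  classical
  let := P.fin
  refine ⟨∏ c with v ∉ P.con c, P.val c s, fun d => ?_⟩
  have hrest : ∏ c with v ∉ P.con c, P.val c s =
      ∏ c with v ∉ P.con c, P.val c (Function.update s v d) := by
    refine Finset.prod_congr rfl fun c hc => P.val_scope c _ _ fun w hw => ?_
    have hwv : w ≠ v := fun h => (Finset.mem_filter.mp hc).2 (h ▸ hw)
    exact (Function.update_of_ne hwv d s).symm
  rw [hrest, mul_comm, pref, payoff]
  convert (Finset.prod_filter_mul_prod_filter_not Finset.univ (fun c => v ∈ P.con c) _).symm

end SCSP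

/-- If multiplication on `M` is strictly monotonic, then every optimal solution
of an SCSP `P` over `M` is a Nash equilibrium of the local game `L(P)`. -/
theorem optimal_isNashLocal {V M : Type} [LinearOrder M] [CommMonoid M] [DecidableEq V]
    (P : SCSP V M)
    (hmono : ∀ a b c : M, a < b → c * a < c * b)
    (s : (v : V) → P.D v) (hs : P.Optimal s) :
    P.NashLocal s := by
  intro v d
  by_contra! hlt
  obtain ⟨r, hr⟩ := P.exists_pref_update_eq_mul_payoff s v
  have hs_eq : P.pref s = r * P.payoff v s := by
    simpa only [Function.update_eq_self] using hr (s v)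
  refine hs ⟨Function.update s v d, ?_⟩
  rw [hs_eq, hr d]
  exact hmono _ _ r hlt
end

section
/- Let P be a consistent classical CSP. Then every solution of P is a Nash equilibrium of the associated local game L(P). -/
theorem SCSP.payoff_eq_one_of_pref_eq_one {V M : Type} [LinearOrder M] [CommMonoid M]
    (hM : ∀ a b : M, a * b = 1 → a = 1) (P : SCSP V M) (v : V)
    (s : (w : V) → P.D w) (hs : P.pref s = 1) : P.payoff v s = 1 := by
  let := P.fin
  classical
  unfold SCSP.pref at hs
  unfold SCSP.payoff
  rw [← Finset.prod_filter_mul_prod_filter_not Finset.univ (fun c => v ∈ P.con c)] at hs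
  convert hM _ _ hs

/-- A classical CSP is an SCSP over `M = {0,1}` (here `Fin 2`, whose
multiplication coincides with `min`, i.e. conjunction) with the order `0 < 1`.
A solution is a full assignment with preference `1`; the CSP is consistent if it
has a solution.  Every solution of a consistent classical CSP is a Nash
equilibrium of the local game `L(P)`. -/
theorem solution_isNashLocal {V : Type} [DecidableEq V]
    (P : SCSP V (Fin 2))
    (hcons : ∃ t : (v : V) → P.D v, P.pref t = 1)
    (s : (v : V) → P.D v) (hs : P.pref s = 1) :
    P.NashLocal s := by
  intro v d
  rw [P.payoff_eq_one_of_pref_eq_one (by decide) v s hs]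
  exact Fin.le_last _
end

section
/- Let G be a strategic game for a finite set N of players with payoff functions p_i into a linearly ordered set A, and for each i ∈ N let f_i : A → A_i be a strictly monotone map into a linearly ordered set A_i. Define pref'(s) := (f_i(p_i(s)))_{i∈N} ∈ WithBot(Π_{i∈N} A_i) if s is a Nash equilibrium of G, and pref'(s) := ⊥ otherwise, where Π_{i∈N} A_i carries its componentwise order and ⊥ is adjoined as a bottom element strictly below all tuples. Then a joint strategy s satisfies (pref'(s) ≠ ⊥ and there is no joint strategy s' with pref'(s) < pref'(s') in this order) if and only if s is a Nash equilibrium of G that is Pareto efficient among the Nash equilibria of G, i.e., no Nash equilibrium s' of G satisfies p_i(s) ≤ p_i(s') for all i ∈ N and p_i(s) < p_i(s') for some i ∈ N. -/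
/-- Let `G` be a strategic game for a finite set `N` of players, with strategy
sets `S i` and payoff functions `p i` into a linearly ordered set `A`, and for
each `i` let `f i : A → A' i` be a strictly monotone map into a linearly
ordered set `A' i`.  Define `pref' s := (f i (p i s))_{i ∈ N}` (an element of
`WithBot (Π i, A' i)`, with the componentwise order on tuples) when `s` is a
Nash equilibrium of `G`, and `pref' s := ⊥` otherwise, where `⊥` is a bottom
element strictly below all tuples.  Then a joint strategy `s` satisfies
`pref' s ≠ ⊥` and no joint strategy `s'` has `pref' s < pref' s'` if and only
if `s` is a Nash equilibrium of `G` that is Pareto efficient among the Nash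
equilibria of `G`.  This encodes the SCSP `L'(G) ∪ H(G)`. -/
theorem optimal_prefBot_iff_paretoEfficientNash {N A : Type} [Fintype N] [DecidableEq N]
    [LinearOrder A]
    (S : N → Type) (hS : ∀ i, Nonempty (S i))
    (p : N → ((j : N) → S j) → A)
    (A' : N → Type) [∀ i, LinearOrder (A' i)]
    (f : (i : N) → A → A' i) (hf : ∀ i, StrictMono (f i))
    (pref' : ((j : N) → S j) → WithBot ((i : N) → A' i))
    (hpref'_nash : ∀ s : (j : N) → S j,
      (∀ (i : N) (t : S i), p i (Function.update s i t) ≤ p i s) →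
        pref' s = ↑(fun i => f i (p i s)))
    (hpref'_not_nash : ∀ s : (j : N) → S j,
      ¬ (∀ (i : N) (t : S i), p i (Function.update s i t) ≤ p i s) →
        pref' s = ⊥)
    (s : (j : N) → S j) :
    (pref' s ≠ ⊥ ∧ ¬ ∃ s' : (j : N) → S j, pref' s < pref' s') ↔
    ((∀ (i : N) (t : S i), p i (Function.update s i t) ≤ p i s) ∧
      ¬ ∃ s' : (j : N) → S j,
        (∀ (i : N) (t : S i), p i (Function.update s' i t) ≤ p i s') ∧
        (∀ i : N, p i s ≤ p i s') ∧ (∃ i : N, p i s < p i s')) := by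
  by_cases hs : ∀ (i : N) (t : S i), p i (Function.update s i t) ≤ p i s
  · have hlt : ∀ s' : (j : N) → S j, pref' s < pref' s' ↔
        (∀ (i : N) (t : S i), p i (Function.update s' i t) ≤ p i s') ∧
          (∀ i : N, p i s ≤ p i s') ∧ (∃ i : N, p i s < p i s') := by
      intro s'
      by_cases hs' : ∀ (i : N) (t : S i), p i (Function.update s' i t) ≤ p i s'
      · rw [hpref'_nash s hs, hpref'_nash s' hs', WithBot.coe_lt_coe, Pi.lt_def]
        simp only [Pi.le_def, (hf _).le_iff_le, (hf _).lt_iff_lt]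
        exact (and_iff_right hs').symm
      · rw [hpref'_not_nash s' hs']
        exact ⟨fun h => absurd h not_lt_bot, fun h => absurd h.1 hs'⟩
    have hne : pref' s ≠ ⊥ := by
      rw [hpref'_nash s hs]
      exact WithBot.coe_ne_bot
    simp only [hlt]
    exact ⟨fun h => ⟨hs, h.2⟩, fun h => ⟨hne, h.2⟩⟩
  · exact ⟨fun h => absurd (hpref'_not_nash s hs) h.1, fun h => absurd h.1 hs⟩
end

section
/- There exists a fuzzy SCSP P such that some optimal solution of P is not a Nash equilibrium of the associated local game L(P). (For instance, the fuzzy SCSP with variables x, y, z, each with domain {a,b}, constraints C_{xy} := {(aa,0.9),(ab,0.6),(ba,0.6),(bb,0.9)} and C_{yz} := {(aa,0.1),(ab,0.2),(ba,0.1),(bb,0.2)}, in which abb is optimal but not a Nash equilibrium of L(P).) -/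
/-- The carrier of the fuzzy c-semiring: the unit interval `[0,1] ⊆ ℝ` with its
usual order. -/
def Fuzzy : Type := {x : ℝ // 0 ≤ x ∧ x ≤ 1}

noncomputable instance : LinearOrder Fuzzy :=
  inferInstanceAs (LinearOrder {x : ℝ // 0 ≤ x ∧ x ≤ 1})

/-- The fuzzy combination operator: `a * b := min a b`, with unit `1`. -/
noncomputable instance : CommMonoid Fuzzy where
  mul a b := min a b
  one := ⟨1, by norm_num⟩
  mul_assoc a b c := min_assoc a b c
  mul_comm a b := min_comm a b
  one_mul a := min_eq_right (by exact a.2.2)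
  mul_one a := min_eq_left (by exact a.2.2)

/-- A player whose variable occurs in exactly one constraint is paid the value of that
constraint. -/
theorem SCSP.payoff_eq_val {V M : Type} [LinearOrder M] [CommMonoid M] (P : SCSP V M) {v : V}
    {c : P.ι} (h : ∀ c', v ∈ P.con c' ↔ c' = c) (s : (w : V) → P.D w) :
    P.payoff v s = P.val c s := by
  let := P.fin
  let := Classical.decPred fun c => v ∈ P.con c
  refine Finset.prod_eq_single_of_mem c (Finset.mem_filter.2 ⟨Finset.mem_univ c, (h c).2 rfl⟩)
    fun c' hc' hne => ?_
  exact absurd ((h c').1 (Finset.mem_filter.1 hc').2) hne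

namespace Fuzzy

/-- The binary fuzzy constraint giving `0.9` to equal values and `0.6` to different ones. -/
noncomputable def agree (x y : Bool) : Fuzzy :=
  if x = y then ⟨9 / 10, by norm_num⟩ else ⟨6 / 10, by norm_num⟩

/-- The fuzzy valuation giving `0.1` to the first value of a variable and `0.2` to the second. -/
noncomputable def preferSnd (z : Bool) : Fuzzy :=
  if z then ⟨2 / 10, by norm_num⟩ else ⟨1 / 10, by norm_num⟩

/-- The fuzzy SCSP on the variables `x, y, z` (numbered `0, 1, 2`), each with domain
`{a, b}` (encoded as `{false, true}`), whose constraints are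
`C_{xy} = {(aa, 0.9), (ab, 0.6), (ba, 0.6), (bb, 0.9)}` (index `false`) and
`C_{yz} = {(aa, 0.1), (ab, 0.2), (ba, 0.1), (bb, 0.2)}` (index `true`). -/
noncomputable def chainSCSP : SCSP (Fin 3) Fuzzy where
  D _ := Bool
  Dne _ := inferInstance
  ι := Bool
  fin := inferInstance
  con c := if c then {1, 2} else {0, 1}
  val c s := if c then preferSnd (s 2) else agree (s 0) (s 1)
  val_scope c s s' h := by cases c <;> simp_all

/-- The assignment `abb` of `chainSCSP`. -/
def abb : (v : Fin 3) → chainSCSP.D v := ![false, true, true]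

theorem chainSCSP_pref (s : (v : Fin 3) → chainSCSP.D v) :
    chainSCSP.pref s = min (preferSnd (s 2)) (agree (s 0) (s 1)) :=
  Fintype.prod_bool _

theorem chainSCSP_payoff_zero (s : (v : Fin 3) → chainSCSP.D v) :
    chainSCSP.payoff 0 s = agree (s 0) (s 1) := by
  have h : ∀ c : Bool, (0 : Fin 3) ∈ (if c then {1, 2} else {0, 1} : Finset (Fin 3)) ↔
      c = false := by
    decide
  exact chainSCSP.payoff_eq_val (c := false) h s

theorem preferSnd_le (z : Bool) : preferSnd z ≤ preferSnd true := by
  cases z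
  · change (1 / 10 : ℝ) ≤ 2 / 10
    norm_num
  · exact le_rfl

theorem optimal_abb : chainSCSP.Optimal abb := by
  rintro ⟨s, hs⟩
  refine hs.not_ge ?_
  have h : preferSnd true ≤ agree false true := by
    change (2 / 10 : ℝ) ≤ 6 / 10
    norm_num
  calc chainSCSP.pref s = min (preferSnd (s 2)) (agree (s 0) (s 1)) := chainSCSP_pref s
    _ ≤ preferSnd (s 2) := min_le_left _ _
    _ ≤ preferSnd true := preferSnd_le (s 2)
    _ = min (preferSnd true) (agree false true) := (min_eq_left h).symm
    _ = chainSCSP.pref abb := (chainSCSP_pref abb).symm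

theorem not_nashLocal_abb : ¬ chainSCSP.NashLocal abb := by
  intro h
  have h0 := h 0 true
  rw [chainSCSP_payoff_zero, chainSCSP_payoff_zero] at h0
  change (9 / 10 : ℝ) ≤ 6 / 10 at h0
  norm_num at h0

end Fuzzy

/-- There exists a fuzzy SCSP `P` (an SCSP over `[0,1]` ordered as usual, with
combination `min`) such that some optimal solution of `P` is not a Nash
equilibrium of the associated local game `L(P)`. -/
theorem exists_fuzzy_optimal_not_nashLocal :
    ∃ (V : Type) (_ : DecidableEq V) (P : SCSP V Fuzzy) (s : (v : V) → P.D v),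
      P.Optimal s ∧ ¬ P.NashLocal s := by
  exact ⟨Fin 3, inferInstance, Fuzzy.chainSCSP, Fuzzy.abb, Fuzzy.optimal_abb,
    Fuzzy.not_nashLocal_abb⟩
end

section
/- There exists a weighted SCSP P such that some Nash equilibrium of the associated local game L(P) is not an optimal solution of P; hence the inclusion of the set of optimal solutions in the set of Nash equilibria of L(P) for SCSPs with strictly monotonic combination can be strict. (For instance, the weighted SCSP with two variables x, y, each with domain {a,b}, and one constraint C_{xy} := {(aa,3),(ab,10),(ba,10),(bb,1)}, in which aa is a Nash equilibrium of L(P) but not optimal.) -/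
/-- The carrier of the weighted c-semiring: nonnegative reals with combination
given by addition and with the order reversed (so that costs are minimized).
`Multiplicative` turns the additive monoid into a multiplicative one, and
`OrderDual` reverses the order. -/
abbrev Weighted : Type := Multiplicative (OrderDual NNReal)


/-- If every scope contains `v`, the payoff of player `v` is the global preference. -/
lemma SCSP.payoff_eq_pref {V M : Type} [LinearOrder M] [CommMonoid M] (P : SCSP V M) {v : V}
    (hv : ∀ c, v ∈ P.con c) (s : (w : V) → P.D w) : P.payoff v s = P.pref s := by
  unfold SCSP.payoff SCSP.pref
  congr 1
  ext c
  simp only [Finset.mem_filter, hv c, and_true]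

/-- The weighted SCSP with two variables, both with domain `Bool`, and one binary constraint
with costs `(aa, 3)`, `(ab, 10)`, `(ba, 10)`, `(bb, 1)`, where `a = true` and `b = false`. -/
def coordinationSCSP : SCSP Bool Weighted where
  D _ := Bool
  Dne _ := inferInstance
  ι := Unit
  fin := inferInstance
  con _ := Finset.univ
  val _ s := Multiplicative.ofAdd (OrderDual.toDual
    (if s true = s false then (if s true then 3 else 1) else 10))
  val_scope _ s s' h := by simp only [h _ (Finset.mem_univ _)]

lemma coordinationSCSP_pref (s : (v : Bool) → coordinationSCSP.D v) :
    coordinationSCSP.pref s = coordinationSCSP.val Unit.unit s :=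
  Fintype.prod_unique (ι := Unit) _

lemma coordinationSCSP_payoff (v : Bool) (s : (v : Bool) → coordinationSCSP.D v) :
    coordinationSCSP.payoff v s = coordinationSCSP.val Unit.unit s :=
  (SCSP.payoff_eq_pref _ (fun _ => Finset.mem_univ v) s).trans (coordinationSCSP_pref s)

/-- There exists a weighted SCSP `P` such that some Nash equilibrium of the
associated local game `L(P)` is not an optimal solution of `P`; hence the
inclusion of the set of optimal solutions in the set of Nash equilibria of
`L(P)` for SCSPs with strictly monotonic combination can be strict. -/
theorem exists_weighted_nashLocal_not_optimal :
    ∃ (V : Type) (_ : DecidableEq V) (P : SCSP V Weighted) (s : (v : V) → P.D v),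
      P.NashLocal s ∧ ¬ P.Optimal s := by
  refine ⟨Bool, inferInstance, coordinationSCSP, fun _ => true, fun v d => ?_,
    not_not.mpr ⟨fun _ => false, ?_⟩⟩
  · refine (coordinationSCSP_payoff v _).trans_le
      (le_of_le_of_eq ?_ (coordinationSCSP_payoff v _).symm)
    change (3 : NNReal) ≤ if Function.update (fun _ => true) v d true =
      Function.update (fun _ => true) v d false then
        (if Function.update (fun _ => true) v d true then 3 else 1) else 10
    change Bool at d
    cases v <;> cases d <;> simp <;> norm_num
  · refine (coordinationSCSP_pref _).trans_lt
      (lt_of_lt_of_eq ?_ (coordinationSCSP_pref _).symm)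
    change (1 : NNReal) < 3
    norm_num
end

section
/- There exists a consistent classical CSP P such that some Nash equilibrium of the associated local game L(P) is not a solution of P. (For instance, the CSP with variables x, y, z, each with domain {a,b}, and constraints C_{xy} and C_{yz} each allowing only the tuple aa, for which aaa is a solution while bbb is a Nash equilibrium of L(P) but not a solution.) -/
/-- The classical CSP with variables `x, y, z` (`0, 1, 2 : Fin 3`), each with domain `{a, b}`
(`a = false`, `b = true`), and constraints `C_xy`, `C_yz` each allowing only the tuple `aa`. -/
def SCSP.chain : SCSP (Fin 3) (Fin 2) where
  D _ := Bool
  Dne _ := ⟨false⟩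
  ι := Fin 2
  fin := inferInstance
  con i := {i.castSucc, i.succ}
  val i s := if s i.castSucc || s i.succ then 0 else 1
  val_scope i s s' h := by
    rw [h i.castSucc (by simp), h i.succ (by simp)]

theorem SCSP.chain_pref (s : Fin 3 → Bool) :
    chain.pref s = (if s 0 || s 1 then 0 else 1) * (if s 1 || s 2 then 0 else 1) :=
  Fin.prod_univ_two _

theorem SCSP.chain_payoff (v : Fin 3) (s : Fin 3 → Bool) :
    chain.payoff v s = (if v = 0 ∨ v = 1 then (if s 0 || s 1 then 0 else 1) else 1) *
      (if v = 1 ∨ v = 2 then (if s 1 || s 2 then 0 else 1) else 1) := by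
  unfold payoff
  rw [Finset.prod_filter]
  refine (Fin.prod_univ_two _).trans ?_
  simp [chain]

/-- The constant assignment `bbb` is a Nash equilibrium, since every unilateral deviation still
violates all the constraints. -/
theorem SCSP.chain_nashLocal : chain.NashLocal fun _ => true := by
  intro v d
  change Bool at d
  refine (chain_payoff v (Function.update (fun _ => true) v d)).trans_le
    (le_of_le_of_eq ?_ (chain_payoff v fun _ => true).symm)
  revert v d
  decide

/-- There exists a consistent classical CSP `P` (an SCSP over `{0,1}`, here
`Fin 2` whose multiplication coincides with `min`, i.e. conjunction, with the
order `0 < 1`; a solution is a full assignment with preference `1`, and `P` is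
consistent since it has a solution) such that some Nash equilibrium of the
associated local game `L(P)` is not a solution of `P`. -/
theorem exists_consistent_csp_nashLocal_not_solution :
    ∃ (V : Type) (_ : DecidableEq V) (P : SCSP V (Fin 2)) (s : (v : V) → P.D v),
      (∃ t : (v : V) → P.D v, P.pref t = 1) ∧ P.NashLocal s ∧ P.pref s ≠ 1 := by
  refine ⟨Fin 3, inferInstance, SCSP.chain, fun _ => true, ⟨fun _ => false, ?_⟩,
    SCSP.chain_nashLocal, ?_⟩ <;> rw [SCSP.chain_pref] <;> decide
end
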